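/- arXiv:quant-ph/0509124 — 5 statements merged into one kernel-verified Lean document; each statement's English description precedes it below -/
import Mathlib

section
/- Let ρ be a density matrix of an m×n bipartite quantum system (a positive semidefinite complex matrix indexed by (Fin m × Fin n) with trace 1). Then ρ is separable if and only if its tilde transform admits a conic decomposition into rank-one partial isometries with positive matricizations: there exist K ∈ ℕ, positive reals μ₁,…,μ_K, vectors u₁,…,u_K ∈ ℂ^(Fin n × Fin n) and v₁,…,v_K ∈ ℂ^(Fin m × Fin m) such that t(ρ) = ∑_{i=1}^K μᵢ |uᵢ⟩⟨vᵢ| and mat(uᵢ) is positive semidefinite and mat(vᵢ) is positive semidefinite for all i. -/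
open Matrix Kronecker
open scoped ComplexOrder

noncomputable section

/-- The `mat` operator, inverse of `vec`: `(matM u) r c = u (c, r)`. -/
def matM {n : ℕ} (u : Fin n × Fin n → ℂ) : Matrix (Fin n) (Fin n) ℂ :=
  Matrix.of fun r c => u (c, r)

/-- The tilde transform: `tildeT Q ((c,r), (i,j)) = Q ((i,r), (j,c))`. -/
def tildeT {m n : ℕ} (Q : Matrix (Fin m × Fin n) (Fin m × Fin n) ℂ) :
    Matrix (Fin n × Fin n) (Fin m × Fin m) ℂ :=
  Matrix.of fun p q => Q (q.1, p.2) (q.2, p.1)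

/-- The outer product `|u⟩⟨v|`, with entries `u a * conj (v b)`. -/
def outerP {α β : Type*} (u : α → ℂ) (v : β → ℂ) : Matrix α β ℂ :=
  Matrix.of fun a b => u a * star (v b)

/-- A density matrix on `ℂ^m ⊗ ℂ^n` is separable if it is a conic combination of
Kronecker products of density matrices. -/
def SeparableState {m n : ℕ} (ρ : Matrix (Fin m × Fin n) (Fin m × Fin n) ℂ) : Prop :=
  ∃ (K : ℕ) (μ : Fin K → ℝ) (ρs : Fin K → Matrix (Fin m) (Fin m) ℂ)
    (σs : Fin K → Matrix (Fin n) (Fin n) ℂ),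
    (∀ i, 0 < μ i) ∧
    (∀ i, (ρs i).PosSemidef ∧ (ρs i).trace = 1) ∧
    (∀ i, (σs i).PosSemidef ∧ (σs i).trace = 1) ∧
    ρ = ∑ i, (μ i : ℂ) • (ρs i ⊗ₖ σs i)

theorem matM_conjTranspose_apply {n : ℕ} (u : Fin n × Fin n → ℂ) (i j : Fin n) :
    (matM u)ᴴ i j = star (u (i, j)) := rfl

theorem tildeT_injective {m n : ℕ} : Function.Injective (tildeT (m := m) (n := n)) := by
  intro P Q h
  ext ⟨i, r⟩ ⟨j, c⟩
  exact congrFun (congrFun h (c, r)) (i, j)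

theorem tildeT_sum_smul_kronecker {m n K : ℕ} (μ : Fin K → ℝ)
    (u : Fin K → (Fin n × Fin n → ℂ)) (v : Fin K → (Fin m × Fin m → ℂ)) :
    tildeT (∑ k, (μ k : ℂ) • ((matM (v k))ᴴ ⊗ₖ matM (u k))) =
      ∑ k, (μ k : ℂ) • outerP (u k) (v k) := by
  ext ⟨c, r⟩ ⟨i, j⟩
  simp only [tildeT, outerP, Matrix.of_apply, Matrix.sum_apply, Matrix.smul_apply,
    Matrix.kroneckerMap_apply, matM_conjTranspose_apply]
  refine Finset.sum_congr rfl fun k _ => ?_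
  rw [mul_comm (star _)]
  rfl

theorem SeparableState.of_fintype {m n : ℕ} {ι : Type*} [Fintype ι]
    {ρ : Matrix (Fin m × Fin n) (Fin m × Fin n) ℂ} (μ : ι → ℝ)
    (A : ι → Matrix (Fin m) (Fin m) ℂ) (B : ι → Matrix (Fin n) (Fin n) ℂ)
    (hμ : ∀ i, 0 < μ i) (hA : ∀ i, (A i).PosSemidef ∧ (A i).trace = 1)
    (hB : ∀ i, (B i).PosSemidef ∧ (B i).trace = 1)
    (h : ρ = ∑ i, (μ i : ℂ) • (A i ⊗ₖ B i)) : SeparableState ρ := by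
  let e := (Fintype.equivFin ι).symm
  refine ⟨Fintype.card ι, μ ∘ e, A ∘ e, B ∘ e, fun i => hμ _, fun i => hA _, fun i => hB _, ?_⟩
  rw [h]
  exact (Equiv.sum_comp e fun i => (μ i : ℂ) • (A i ⊗ₖ B i)).symm

theorem Matrix.PosSemidef.exists_eq_smul_trace_one {n : ℕ} {A : Matrix (Fin n) (Fin n) ℂ}
    (hA : A.PosSemidef) (h : A ≠ 0) :
    ∃ (t : ℝ) (B : Matrix (Fin n) (Fin n) ℂ),
      0 < t ∧ B.PosSemidef ∧ B.trace = 1 ∧ A = (t : ℂ) • B := by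
  have htr : A.trace ≠ 0 := fun h0 => h (hA.trace_eq_zero_iff.1 h0)
  obtain ⟨t, ht, hAt⟩ : ∃ t : ℝ, 0 ≤ t ∧ (t : ℂ) = A.trace :=
    ⟨A.trace.re, (Complex.le_def.1 hA.trace_nonneg).1,
      (Complex.eq_re_of_ofReal_le (r := 0) (by simpa using hA.trace_nonneg)).symm⟩
  have ht0 : (t : ℂ) ≠ 0 := hAt ▸ htr
  refine ⟨t, (t : ℂ)⁻¹ • A, lt_of_le_of_ne ht fun h0 => ht0 (by simp [← h0]), hA.smul ?_, ?_, ?_⟩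
  · rw [← Complex.ofReal_inv]
    exact_mod_cast inv_nonneg.2 ht
  · rw [Matrix.trace_smul, ← hAt, smul_eq_mul, inv_mul_cancel₀ ht0]
  · rw [smul_smul, mul_inv_cancel₀ ht0, one_smul]

theorem SeparableState.of_posSemidef {m n K : ℕ}
    {ρ : Matrix (Fin m × Fin n) (Fin m × Fin n) ℂ} (μ : Fin K → ℝ)
    (A : Fin K → Matrix (Fin m) (Fin m) ℂ) (B : Fin K → Matrix (Fin n) (Fin n) ℂ)
    (hμ : ∀ i, 0 < μ i) (hA : ∀ i, (A i).PosSemidef) (hB : ∀ i, (B i).PosSemidef)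
    (h : ρ = ∑ i, (μ i : ℂ) • (A i ⊗ₖ B i)) : SeparableState ρ := by
  classical
  let S := {i : Fin K // A i ≠ 0 ∧ B i ≠ 0}
  choose a A' ha hA' hA'tr hAa using fun i : S => (hA i).exists_eq_smul_trace_one i.2.1
  choose b B' hb hB' hB'tr hBb using fun i : S => (hB i).exists_eq_smul_trace_one i.2.2
  refine SeparableState.of_fintype (ι := S) (fun i => μ i * a i * b i) A' B'
    (fun i => mul_pos (mul_pos (hμ i) (ha i)) (hb i)) (fun i => ⟨hA' i, hA'tr i⟩)
    (fun i => ⟨hB' i, hB'tr i⟩) ?_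
  calc ρ = ∑ i with A i ≠ 0 ∧ B i ≠ 0, (μ i : ℂ) • (A i ⊗ₖ B i) := by
        rw [h, Finset.sum_filter_of_ne]
        rintro i - hi
        constructor <;> intro h0 <;> simp [h0] at hi
    _ = ∑ i : S, (μ i : ℂ) • (A i ⊗ₖ B i) := Finset.sum_subtype _ (by simp) _
    _ = _ := by
        refine Finset.sum_congr rfl fun i _ => ?_
        rw [hAa i, hBb i, Matrix.smul_kronecker, Matrix.kronecker_smul, smul_smul, smul_smul]
        push_cast
        ring_nf

/-- A density matrix `ρ` of an `m × n` bipartite system is separable if and only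
if its tilde transform admits a conic decomposition into rank-one partial
isometries `t(ρ) = ∑ μᵢ |uᵢ⟩⟨vᵢ|` with `mat uᵢ ≥ 0` and `mat vᵢ ≥ 0`. -/
theorem separable_iff_tilde_conic_decomposition {m n : ℕ}
    (ρ : Matrix (Fin m × Fin n) (Fin m × Fin n) ℂ)
    (hρ : ρ.PosSemidef) (htr : ρ.trace = 1) :
    SeparableState ρ ↔
      ∃ (K : ℕ) (μ : Fin K → ℝ) (u : Fin K → (Fin n × Fin n → ℂ))
        (v : Fin K → (Fin m × Fin m → ℂ)),
        (∀ i, 0 < μ i) ∧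
        tildeT ρ = ∑ i, (μ i : ℂ) • outerP (u i) (v i) ∧
        (∀ i, (matM (u i)).PosSemidef) ∧
        (∀ i, (matM (v i)).PosSemidef) := by
  constructor
  · rintro ⟨K, μ, A, B, hμ, hA, hB, rfl⟩
    refine ⟨K, μ, fun k p => B k p.2 p.1, fun k p => A k p.2 p.1, hμ, ?_,
      fun k => (hB k).1, fun k => (hA k).1⟩
    rw [← tildeT_sum_smul_kronecker]
    congr! with k
    exact (hA k).1.isHermitian.symm
  · rintro ⟨K, μ, u, v, hμ, h, hu, hv⟩
    rw [← tildeT_sum_smul_kronecker] at h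
    exact SeparableState.of_posSemidef μ _ _ hμ (fun k => (hv k).conjTranspose) hu
      (tildeT_injective h)
end
end

section
/- Let ρ be a density matrix of an m×n bipartite quantum system (a positive semidefinite complex matrix indexed by (Fin m × Fin n) with trace 1). Suppose its tilde transform admits a decomposition t(ρ) = ∑_{i=1}^q σᵢ |vᵢ⟩⟨wᵢ| where σᵢ > 0 are real, {v₁,…,v_q} is an orthonormal family in ℂ^(Fin n × Fin n), and {w₁,…,w_q} is an orthonormal family in ℂ^(Fin m × Fin m) (i.e., vᵢ, wᵢ are left and right singular vectors of t(ρ) associated to its non-null singular values). If mat(vᵢ) is positive semidefinite and mat(wᵢ) is positive semidefinite for all i = 1,…,q, then ρ is separable. -/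
open Matrix Kronecker
open scoped ComplexOrder

noncomputable section

/-- A nonzero positive semidefinite matrix is a positive multiple of a density matrix. -/
theorem Matrix.PosSemidef.exists_pos_smul_density {ι : Type*} [Fintype ι]
    {A : Matrix ι ι ℂ} (hA : A.PosSemidef) (h0 : A ≠ 0) :
    ∃ (t : ℝ) (B : Matrix ι ι ℂ), 0 < t ∧ (B.PosSemidef ∧ B.trace = 1) ∧ A = (t : ℂ) • B := by
  have htr : 0 < A.trace :=
    lt_of_le_of_ne hA.trace_nonneg fun h => h0 (hA.trace_eq_zero_iff.mp h.symm)
  have hre : ((A.trace.re : ℝ) : ℂ) = A.trace :=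
    (Complex.eq_re_of_ofReal_le (r := 0) (by simpa using htr.le)).symm
  refine ⟨A.trace.re, A.trace⁻¹ • A, (Complex.pos_iff.mp htr).1, ⟨hA.smul ?_, ?_⟩, ?_⟩
  · rw [← hre, ← Complex.ofReal_inv]
    exact_mod_cast inv_nonneg.mpr (Complex.pos_iff.mp htr).1.le
  · rw [trace_smul, smul_eq_mul, inv_mul_cancel₀ htr.ne']
  · rw [hre, smul_smul, mul_inv_cancel₀ htr.ne', one_smul]

theorem matM_ne_zero {n : ℕ} {u : Fin n × Fin n → ℂ} (hu : ∑ k, star (u k) * u k = 1) :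
    matM u ≠ 0 := by
  intro h
  have hz : ∀ k, u k = 0 := fun k => congrFun (congrFun h k.2) k.1
  simp [hz] at hu

theorem eq_sum_kronecker_of_tildeT_eq {m n q : ℕ}
    {ρ : Matrix (Fin m × Fin n) (Fin m × Fin n) ℂ} {σ : Fin q → ℝ}
    {v : Fin q → (Fin n × Fin n → ℂ)} {w : Fin q → (Fin m × Fin m → ℂ)}
    (h : tildeT ρ = ∑ i, (σ i : ℂ) • outerP (v i) (w i))
    (hw : ∀ i, (matM (w i)).IsHermitian) :
    ρ = ∑ i, (σ i : ℂ) • (matM (w i) ⊗ₖ matM (v i)) := by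
  ext ⟨i, r⟩ ⟨j, c⟩
  have hentry : ρ (i, r) (j, c) = _ := congrFun (congrFun h (c, r)) (i, j)
  rw [hentry, Matrix.sum_apply, Matrix.sum_apply]
  refine Finset.sum_congr rfl fun k _ => ?_
  have hk : star (w k (i, j)) = matM (w k) i j := (hw k).apply i j
  rw [Matrix.smul_apply, Matrix.smul_apply, kroneckerMap_apply, ← hk]
  simp [outerP, matM, mul_comm]

/-- Sufficient criterion for separability from the singular value decomposition:
if `t(ρ) = ∑ σᵢ |vᵢ⟩⟨wᵢ|` with `σᵢ > 0`, `{vᵢ}` and `{wᵢ}` orthonormal families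
(left/right singular vectors attached to the non-null singular values), and all
the matricizations `mat vᵢ`, `mat wᵢ` are positive semidefinite,
then `ρ` is separable. -/
theorem svd_psd_implies_separable {m n : ℕ}
    (ρ : Matrix (Fin m × Fin n) (Fin m × Fin n) ℂ)
    (hρ : ρ.PosSemidef) (htr : ρ.trace = 1)
    (q : ℕ) (σ : Fin q → ℝ)
    (v : Fin q → (Fin n × Fin n → ℂ)) (w : Fin q → (Fin m × Fin m → ℂ))
    (hσ : ∀ i, 0 < σ i)
    (hv : ∀ i j, ∑ k, star (v i k) * v j k = if i = j then (1 : ℂ) else 0)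
    (hw : ∀ i j, ∑ k, star (w i k) * w j k = if i = j then (1 : ℂ) else 0)
    (hdecomp : tildeT ρ = ∑ i, (σ i : ℂ) • outerP (v i) (w i))
    (hmv : ∀ i, (matM (v i)).PosSemidef)
    (hmw : ∀ i, (matM (w i)).PosSemidef) :
    SeparableState ρ := by
  choose a A ha hA hwA using fun i =>
    (hmw i).exists_pos_smul_density (matM_ne_zero (by simpa using hw i i))
  choose b B hb hB hvB using fun i =>
    (hmv i).exists_pos_smul_density (matM_ne_zero (by simpa using hv i i))
  refine ⟨q, fun i => σ i * (a i * b i), A, B,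
    fun i => mul_pos (hσ i) (mul_pos (ha i) (hb i)), hA, hB, ?_⟩
  rw [eq_sum_kronecker_of_tildeT_eq hdecomp fun i => (hmw i).isHermitian]
  refine Finset.sum_congr rfl fun i _ => ?_
  rw [hwA i, hvB i, smul_kronecker, kronecker_smul, smul_smul, smul_smul]
  push_cast
  ring_nf
end
end

section
/- Let ρ be a density matrix of an m×n bipartite quantum system (a positive semidefinite complex matrix indexed by (Fin m × Fin n) with trace 1). Then ρ is a product state, i.e., ρ = ρ₁ ⊗ ρ₂ for some density matrices ρ₁ (m×m) and ρ₂ (n×n), if and only if the tilde transform t(ρ) has rank one and there exist a real σ > 0 and unit vectors u ∈ ℂ^(Fin n × Fin n) and v ∈ ℂ^(Fin m × Fin m) with t(ρ) = σ |u⟩⟨v| such that mat(u) is positive semidefinite and mat(v) is positive semidefinite. -/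
open Matrix Kronecker
open scoped ComplexOrder

noncomputable section

/-- A positive semidefinite matrix of trace one is a positive multiple of the matricization of a
unit vector. -/
theorem Matrix.PosSemidef.exists_eq_smul_matM {n : ℕ} {M : Matrix (Fin n) (Fin n) ℂ}
    (hM : M.PosSemidef) (htr : M.trace = 1) :
    ∃ (s : ℝ) (w : Fin n × Fin n → ℂ), 0 < s ∧ (∑ k, star (w k) * w k) = (1 : ℂ) ∧
      (matM w).PosSemidef ∧ M = (s : ℂ) • matM w := by
  set q : ℝ := ∑ k : Fin n × Fin n, ‖M k.2 k.1‖ ^ 2 with hq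
  have hq_nonneg : 0 ≤ q := Finset.sum_nonneg fun _ _ => by positivity
  have hq_ne : q ≠ 0 := by
    intro h0
    rw [hq, Finset.sum_eq_zero_iff_of_nonneg fun _ _ => by positivity] at h0
    have hM0 : M = 0 := by
      ext i j
      simpa using h0 (j, i) (Finset.mem_univ _)
    simp [hM0] at htr
  have hs : 0 < √q := Real.sqrt_pos.2 (lt_of_le_of_ne hq_nonneg hq_ne.symm)
  have hs_ne : ((√q : ℝ) : ℂ) ≠ 0 := by exact_mod_cast hs.ne'
  have hmat : matM (fun k : Fin n × Fin n => ((√q : ℝ) : ℂ)⁻¹ * M k.2 k.1)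
      = ((√q : ℝ) : ℂ)⁻¹ • M := by
    ext i j
    simp [matM]
  refine ⟨√q, fun k => ((√q : ℝ) : ℂ)⁻¹ * M k.2 k.1, hs, ?_, ?_, ?_⟩
  · have hterm : ∀ k : Fin n × Fin n,
        star (((√q : ℝ) : ℂ)⁻¹ * M k.2 k.1) * (((√q : ℝ) : ℂ)⁻¹ * M k.2 k.1)
          = ((q⁻¹ * ‖M k.2 k.1‖ ^ 2 : ℝ) : ℂ) := by
      intro k
      rw [Complex.star_def, Complex.conj_mul', norm_mul, norm_inv, Complex.norm_real,
        Real.norm_of_nonneg hs.le, ← Complex.ofReal_pow, mul_pow, inv_pow, Real.sq_sqrt hq_nonneg]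
    rw [Finset.sum_congr rfl fun k _ => hterm k, ← Complex.ofReal_sum, ← Finset.mul_sum, ← hq,
      inv_mul_cancel₀ hq_ne, Complex.ofReal_one]
  · rw [hmat]
    exact hM.smul (inv_nonneg.2 (by exact_mod_cast hs.le))
  · rw [hmat, smul_smul, mul_inv_cancel₀ hs_ne, one_smul]

/-- If `v` has Hermitian matricization, then `t(Q) = c |u⟩⟨v|` exactly when
`Q = c mat(v) ⊗ mat(u)`. -/
theorem tildeT_eq_smul_outerP_iff {m n : ℕ} {Q : Matrix (Fin m × Fin n) (Fin m × Fin n) ℂ}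
    {c : ℂ} {u : Fin n × Fin n → ℂ} {v : Fin m × Fin m → ℂ} (hv : (matM v).IsHermitian) :
    tildeT Q = c • outerP u v ↔ Q = c • (matM v ⊗ₖ matM u) := by
  have hstar : ∀ i j, star (v (i, j)) = v (j, i) := fun i j => hv.apply i j
  constructor
  · intro h
    ext ⟨i, r⟩ ⟨j, k⟩
    have := congrFun (congrFun h (k, r)) (i, j)
    simp only [tildeT, outerP, matM, of_apply, Matrix.smul_apply, kroneckerMap_apply, hstar] at this ⊢
    rw [this, mul_comm (u _)]
  · rintro rfl
    ext ⟨k, r⟩ ⟨i, j⟩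
    simp only [tildeT, outerP, matM, of_apply, Matrix.smul_apply, kroneckerMap_apply, hstar]
    rw [mul_comm (u _)]

theorem rank_outerP_smul_le {α β : Type*} [Fintype α] [Fintype β] (c : ℂ) (u : α → ℂ) (v : β → ℂ) :
    (c • outerP u v).rank ≤ 1 := by
  have h : c • outerP u v = vecMulVec (c • u) (star v) := by
    ext a b
    simp [outerP, vecMulVec_apply, mul_assoc]
  rw [h]
  exact rank_vecMulVec_le _ _

theorem eq_zero_of_tildeT_eq_zero {m n : ℕ} {Q : Matrix (Fin m × Fin n) (Fin m × Fin n) ℂ}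
    (h : tildeT Q = 0) : Q = 0 := by
  ext ⟨i, r⟩ ⟨j, k⟩
  exact congrFun (congrFun h (k, r)) (i, j)

/-- A density matrix `ρ` of an `m × n` bipartite system is a product state
`ρ = ρ₁ ⊗ ρ₂` if and only if `t(ρ)` has rank one and the (unit) left/right
singular vectors `u`, `v` attached to its non-null singular value `σ` (so that
`t(ρ) = σ |u⟩⟨v|`) have positive semidefinite matricizations. -/
theorem product_state_iff_tilde_rank_one {m n : ℕ}
    (ρ : Matrix (Fin m × Fin n) (Fin m × Fin n) ℂ)
    (hρ : ρ.PosSemidef) (htr : ρ.trace = 1) :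
    (∃ (ρ₁ : Matrix (Fin m) (Fin m) ℂ) (ρ₂ : Matrix (Fin n) (Fin n) ℂ),
        ρ₁.PosSemidef ∧ ρ₁.trace = 1 ∧ ρ₂.PosSemidef ∧ ρ₂.trace = 1 ∧
        ρ = ρ₁ ⊗ₖ ρ₂) ↔
      ((tildeT ρ).rank = 1 ∧
        ∃ (σ : ℝ) (u : Fin n × Fin n → ℂ) (v : Fin m × Fin m → ℂ),
          0 < σ ∧
          (∑ k, star (u k) * u k) = (1 : ℂ) ∧
          (∑ k, star (v k) * v k) = (1 : ℂ) ∧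
          tildeT ρ = (σ : ℂ) • outerP u v ∧
          (matM u).PosSemidef ∧ (matM v).PosSemidef) := by
  constructor
  · rintro ⟨ρ₁, ρ₂, h₁, ht₁, h₂, ht₂, hprod⟩
    obtain ⟨s, v, hs, hv, hvp, rfl⟩ := h₁.exists_eq_smul_matM ht₁
    obtain ⟨t, u, ht, hu, hup, rfl⟩ := h₂.exists_eq_smul_matM ht₂
    have htilde : tildeT ρ = ((s * t : ℝ) : ℂ) • outerP u v := by
      rw [tildeT_eq_smul_outerP_iff hvp.isHermitian, hprod, smul_kronecker, kronecker_smul,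
        smul_smul, Complex.ofReal_mul]
    refine ⟨le_antisymm ?_ ?_, s * t, u, v, mul_pos hs ht, hu, hv, htilde, hup, hvp⟩
    · rw [htilde]
      exact rank_outerP_smul_le _ _ _
    · rw [Nat.one_le_iff_ne_zero, Ne, rank, Submodule.finrank_eq_zero, LinearMap.range_eq_bot,
        ← toLin'_apply', map_eq_zero_iff toLin' toLin'.injective]
      intro h0
      simp [eq_zero_of_tildeT_eq_zero h0] at htr
  · rintro ⟨-, σ, u, v, hσ, -, -, htilde, hup, hvp⟩
    rw [tildeT_eq_smul_outerP_iff hvp.isHermitian] at htilde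
    have htrace : (σ : ℂ) * ((matM v).trace * (matM u).trace) = 1 := by
      rw [← htr, htilde, trace_smul, trace_kronecker, smul_eq_mul]
    have hv_ne : (matM v).trace ≠ 0 := by
      intro h0
      simp [h0] at htrace
    refine ⟨(matM v).trace⁻¹ • matM v, ((σ : ℂ) * (matM v).trace) • matM u,
      hvp.smul (inv_nonneg.2 hvp.trace_nonneg), ?_,
      hup.smul (mul_nonneg (by exact_mod_cast hσ.le) hvp.trace_nonneg), ?_, ?_⟩
    · rw [trace_smul, smul_eq_mul, inv_mul_cancel₀ hv_ne]
    · rw [trace_smul, smul_eq_mul, mul_assoc, htrace]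
    · rw [smul_kronecker, kronecker_smul, smul_smul, htilde, mul_comm (σ : ℂ),
        inv_mul_cancel_left₀ hv_ne]
end
end

section
/- Let ρ be a density matrix of an m×n bipartite quantum system (a positive semidefinite complex matrix indexed by (Fin m × Fin n) with trace 1). Then ρ is separable if and only if there exist K ∈ ℕ, positive reals μ₁,…,μ_K, and vectors x₁,…,x_K ∈ ℂ^n and y₁,…,y_K ∈ ℂ^m such that t(ρ) = ∑_{i=1}^K μᵢ |uᵢ⟩⟨vᵢ| where uᵢ ∈ ℂ^(Fin n × Fin n) is given by uᵢ(c,r) = conj(xᵢ(c)) · xᵢ(r) (i.e., uᵢ = x̄ᵢ ⊗ xᵢ) and vᵢ ∈ ℂ^(Fin m × Fin m) is given by vᵢ(c,r) = conj(yᵢ(c)) · yᵢ(r) (i.e., vᵢ = ȳᵢ ⊗ yᵢ). -/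
open Matrix Kronecker
open scoped ComplexOrder

noncomputable section

namespace Matrix.PosSemidef

/-- A nonzero positive semidefinite matrix is a positive multiple of one with trace one. -/
theorem exists_pos_smul_trace_eq_one {k : Type*} [Fintype k] {A : Matrix k k ℂ}
    (hA : A.PosSemidef) (h0 : A ≠ 0) :
    ∃ (a : ℝ) (N : Matrix k k ℂ), 0 < a ∧ (N.PosSemidef ∧ N.trace = 1) ∧ A = (a : ℂ) • N := by
  have hpos : 0 < A.trace := hA.trace_nonneg.lt_of_ne' (mt hA.trace_eq_zero_iff.mp h0)
  obtain ⟨a, ha, htr⟩ := RCLike.pos_iff_exists_ofReal.mp hpos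
  have hne : (a : ℂ) ≠ 0 := Complex.ofReal_ne_zero.mpr ha.ne'
  refine ⟨a, (a : ℂ)⁻¹ • A, ha, ⟨hA.smul ?_, ?_⟩, ?_⟩
  · rw [← Complex.ofReal_inv]
    exact Complex.zero_le_real.mpr (inv_nonneg.mpr ha.le)
  · rw [trace_smul, ← htr, smul_eq_mul]
    exact inv_mul_cancel₀ hne
  · rw [smul_inv_smul₀ hne]

end Matrix.PosSemidef

/-- A finite sum of Kronecker products of positive semidefinite matrices is separable. -/
theorem SeparableState.of_sum_kronecker {m n : ℕ} {ι : Type*} [Fintype ι]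
    {A : ι → Matrix (Fin m) (Fin m) ℂ} {B : ι → Matrix (Fin n) (Fin n) ℂ}
    (hA : ∀ i, (A i).PosSemidef) (hB : ∀ i, (B i).PosSemidef) :
    SeparableState (∑ i, A i ⊗ₖ B i) := by
  classical
  let S := {i // A i ≠ 0 ∧ B i ≠ 0}
  choose a N ha hN hAN using fun i : S => (hA i).exists_pos_smul_trace_eq_one i.2.1
  choose b M hb hM hBM using fun i : S => (hB i).exists_pos_smul_trace_eq_one i.2.2
  let e := (Fintype.equivFin S).symm
  refine ⟨Fintype.card S, fun k => a (e k) * b (e k), fun k => N (e k), fun k => M (e k),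
    fun k => mul_pos (ha _) (hb _), fun k => hN _, fun k => hM _, ?_⟩
  rw [e.sum_comp fun i => ((a i * b i : ℝ) : ℂ) • (N i ⊗ₖ M i)]
  calc ∑ i, A i ⊗ₖ B i = ∑ i with A i ≠ 0 ∧ B i ≠ 0, A i ⊗ₖ B i := by
        refine (Finset.sum_filter_of_ne fun i _ h => ⟨?_, ?_⟩).symm
        · rintro h0
          simp [h0] at h
        · rintro h0
          simp [h0] at h
    _ = ∑ i : S, A i ⊗ₖ B i := Finset.sum_subtype _ (by simp) _
    _ = _ := Finset.sum_congr rfl fun i _ => by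
        rw [hAN i, hBM i, smul_kronecker, kronecker_smul, smul_smul, Complex.ofReal_mul]

/-- The decomposition of `tildeT ρ` into outer products of vectors `x̄ ⊗ x` and `ȳ ⊗ y` is the
decomposition of `ρ` into Kronecker products of rank-one projections. -/
theorem tildeT_eq_sum_outerP_iff {m n : ℕ} {ι : Type*} [Fintype ι]
    (ρ : Matrix (Fin m × Fin n) (Fin m × Fin n) ℂ) (μ : ι → ℝ)
    (x : ι → Fin n → ℂ) (y : ι → Fin m → ℂ) :
    tildeT ρ = ∑ i, (μ i : ℂ) •
        outerP (fun p : Fin n × Fin n => star (x i p.1) * x i p.2)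
          (fun p : Fin m × Fin m => star (y i p.1) * y i p.2) ↔
      ρ = ∑ i, (μ i : ℂ) • (vecMulVec (y i) (star (y i)) ⊗ₖ vecMulVec (x i) (star (x i))) := by
  have entry (i j : Fin m) (c r : Fin n) :
      (∑ k, (μ k : ℂ) • outerP (fun p : Fin n × Fin n => star (x k p.1) * x k p.2)
          (fun p : Fin m × Fin m => star (y k p.1) * y k p.2)) (c, r) (i, j) =
        (∑ k, (μ k : ℂ) • (vecMulVec (y k) (star (y k)) ⊗ₖ vecMulVec (x k) (star (x k))))
          (i, r) (j, c) := by
    simp only [Matrix.sum_apply, Matrix.smul_apply, outerP, of_apply, kroneckerMap_apply, vecMulVec_apply,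
      Pi.star_apply, star_mul', star_star, smul_eq_mul]
    exact Finset.sum_congr rfl fun k _ => by ring
  constructor
  · intro h
    ext ⟨i, r⟩ ⟨j, c⟩
    rw [← entry, ← h]
    rfl
  · intro h
    ext ⟨c, r⟩ ⟨i, j⟩
    rw [entry, ← h]
    rfl

/-- A separable state is a conic combination of Kronecker products of rank-one positive
semidefinite matrices. -/
theorem SeparableState.exists_sum_vecMulVec {m n : ℕ}
    {ρ : Matrix (Fin m × Fin n) (Fin m × Fin n) ℂ} (h : SeparableState ρ) :
    ∃ (K : ℕ) (μ : Fin K → ℝ) (x : Fin K → Fin n → ℂ) (y : Fin K → Fin m → ℂ),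
      (∀ i, 0 < μ i) ∧
      ρ = ∑ i, (μ i : ℂ) •
        (vecMulVec (y i) (star (y i)) ⊗ₖ vecMulVec (x i) (star (x i))) := by
  obtain ⟨K, μ, ρs, σs, hμ, hρs, hσs, rfl⟩ := h
  choose p y hy using fun i => posSemidef_iff_eq_sum_vecMulVec.mp (hρs i).1
  choose q x hx using fun i => posSemidef_iff_eq_sum_vecMulVec.mp (hσs i).1
  let e := (Fintype.equivFin (Σ i, Fin (p i) × Fin (q i))).symm
  refine ⟨_, fun k => μ (e k).1, fun k => x _ (e k).2.2, fun k => y _ (e k).2.1,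
    fun k => hμ _, ?_⟩
  rw [e.sum_comp fun s => (μ s.1 : ℂ) • (vecMulVec (y s.1 s.2.1) (star (y s.1 s.2.1)) ⊗ₖ
    vecMulVec (x s.1 s.2.2) (star (x s.1 s.2.2))), Fintype.sum_sigma]
  refine Finset.sum_congr rfl fun i _ => ?_
  rw [hy i, hx i, Fintype.sum_prod_type]
  ext ⟨a, b⟩ ⟨c, d⟩
  simp only [Matrix.sum_apply, Matrix.smul_apply, kroneckerMap_apply, Finset.sum_mul_sum,
    Finset.smul_sum]

/-- A density matrix `ρ` of an `m × n` bipartite system is separable if and only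
if `t(ρ)` is a conic combination of rank-one partial isometries `|uᵢ⟩⟨vᵢ|` where
`uᵢ = x̄ᵢ ⊗ xᵢ` (i.e. `uᵢ (c,r) = conj (xᵢ c) * xᵢ r`) and `vᵢ = ȳᵢ ⊗ yᵢ`
(i.e. `vᵢ (c,r) = conj (yᵢ c) * yᵢ r`). -/
theorem separable_iff_tilde_conic_decomposition_vec_structure {m n : ℕ}
    (ρ : Matrix (Fin m × Fin n) (Fin m × Fin n) ℂ)
    (hρ : ρ.PosSemidef) (htr : ρ.trace = 1) :
    SeparableState ρ ↔
      ∃ (K : ℕ) (μ : Fin K → ℝ) (x : Fin K → (Fin n → ℂ)) (y : Fin K → (Fin m → ℂ)),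
        (∀ i, 0 < μ i) ∧
        tildeT ρ = ∑ i, (μ i : ℂ) •
          outerP (fun p : Fin n × Fin n => star (x i p.1) * x i p.2)
                 (fun p : Fin m × Fin m => star (y i p.1) * y i p.2) := by
  constructor
  · intro h
    simpa only [tildeT_eq_sum_outerP_iff] using h.exists_sum_vecMulVec
  · rintro ⟨K, μ, x, y, hμ, h⟩
    rw [(tildeT_eq_sum_outerP_iff ρ μ x y).mp h]
    simp only [← smul_kronecker]
    exact .of_sum_kronecker
      (fun i => (posSemidef_vecMulVec_self_star _).smul (Complex.zero_le_real.mpr (hμ i).le))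
      (fun i => posSemidef_vecMulVec_self_star _)
end
end

section
/- Let x = (e₀ + e₁)/√2 ∈ ℂ² and consider the state ρ = (1/2)(P_{e₀} ⊗ P_{e₀} + P_x ⊗ P_x) on ℂ² ⊗ ℂ², where P_u = |u⟩⟨u|. Then ρ is separable; nevertheless, there do not exist q ∈ ℕ, positive reals σ₁,…,σ_q, an orthonormal family u₁,…,u_q and an orthonormal family w₁,…,w_q in ℂ^(Fin 2 × Fin 2) such that t(ρ) = ∑_{i=1}^q σᵢ |uᵢ⟩⟨wᵢ| with mat(uᵢ) and mat(wᵢ) positive semidefinite for all i. Hence the singular-value-decomposition criterion is sufficient but not necessary for separability. -/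
open Matrix Kronecker
open scoped ComplexOrder

noncomputable section

/-- The rank-one projector `P_u = |u⟩⟨u|`. -/
def projM {n : ℕ} (u : Fin n → ℂ) : Matrix (Fin n) (Fin n) ℂ :=
  Matrix.of fun r c => u r * star (u c)

/-- The standard basis vectors of `ℂ²`. -/
def e₀ : Fin 2 → ℂ := fun i => if i = 0 then 1 else 0
def e₁ : Fin 2 → ℂ := fun i => if i = 1 then 1 else 0

/-- The vector `x = (e₀ + e₁)/√2 ∈ ℂ²`. -/
def xVec : Fin 2 → ℂ := fun i => (e₀ i + e₁ i) / ((Real.sqrt 2 : ℝ) : ℂ)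

/-- The state `ρ = (1/2)(P_{e₀} ⊗ P_{e₀} + P_x ⊗ P_x)` on `ℂ² ⊗ ℂ²`. -/
def ρEx : Matrix (Fin 2 × Fin 2) (Fin 2 × Fin 2) ℂ :=
  (1 / 2 : ℂ) • (projM e₀ ⊗ₖ projM e₀ + projM xVec ⊗ₖ projM xVec)

theorem projM_posSemidef {n : ℕ} (u : Fin n → ℂ) : (projM u).PosSemidef :=
  Matrix.posSemidef_vecMulVec_self_star u

theorem trace_projM {n : ℕ} (u : Fin n → ℂ) : (projM u).trace = ∑ k, u k * star (u k) := rfl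

theorem trace_projM_e₀ : (projM e₀).trace = 1 := by
  simp [trace_projM, e₀]

theorem inv_sqrt_two_mul_self :
    (((Real.sqrt 2 : ℝ) : ℂ))⁻¹ * (((Real.sqrt 2 : ℝ) : ℂ))⁻¹ = 1 / 2 := by
  rw [← mul_inv, ← Complex.ofReal_mul, Real.mul_self_sqrt (by norm_num)]
  norm_num

theorem projM_xVec_apply (i j : Fin 2) : projM xVec i j = 1 / 2 := by
  fin_cases i <;> fin_cases j <;>
    simpa [projM, xVec, e₀, e₁, Complex.conj_ofReal] using inv_sqrt_two_mul_self

theorem trace_projM_xVec : (projM xVec).trace = 1 := by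
  simp only [Matrix.trace, Matrix.diag_apply, Fin.sum_univ_two, projM_xVec_apply]
  norm_num

theorem separableState_ρEx : SeparableState ρEx := by
  refine ⟨2, fun _ => 1 / 2, ![projM e₀, projM xVec], ![projM e₀, projM xVec], ?_, ?_, ?_, ?_⟩
  · intro i
    norm_num
  · rw [Fin.forall_fin_two]
    exact ⟨⟨projM_posSemidef _, trace_projM_e₀⟩, ⟨projM_posSemidef _, trace_projM_xVec⟩⟩
  · rw [Fin.forall_fin_two]
    exact ⟨⟨projM_posSemidef _, trace_projM_e₀⟩, ⟨projM_posSemidef _, trace_projM_xVec⟩⟩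
  · simp [ρEx, Fin.sum_univ_two, smul_add]

theorem tildeT_ρEx_apply (a b : Fin 2 × Fin 2) :
    tildeT ρEx a b = 1 / 8 + if a = (0, 0) ∧ b = (0, 0) then 1 / 2 else 0 := by
  obtain ⟨c, r⟩ := a
  obtain ⟨i, j⟩ := b
  simp only [tildeT, ρEx, Matrix.of_apply, Matrix.smul_apply, Matrix.add_apply,
    Matrix.kroneckerMap_apply, projM_xVec_apply]
  fin_cases c <;> fin_cases r <;> fin_cases i <;> fin_cases j <;>
    simp [projM, e₀] <;> norm_num

section OuterProductExpansion

variable {α β ι : Type*} [Fintype ι]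
  {s : ι → ℝ} {u : ι → α → ℂ} {w : ι → β → ℂ}

theorem sum_smul_outerP_mulVec [Fintype β] (v : β → ℂ) (a : α) :
    ((∑ i, (s i : ℂ) • outerP (u i) (w i)) *ᵥ v) a =
      ∑ i, (s i : ℂ) * u i a * ∑ b, star (w i b) * v b := by
  simp only [Matrix.mulVec, dotProduct, Matrix.sum_apply, Matrix.smul_apply, outerP,
    Matrix.of_apply, smul_eq_mul, Finset.sum_mul, Finset.mul_sum]
  rw [Finset.sum_comm]
  exact Finset.sum_congr rfl fun _ _ => Finset.sum_congr rfl fun _ _ => by ring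

theorem sum_smul_outerP_mulVec_right [Fintype β] [DecidableEq ι]
    (hw : ∀ i j, ∑ k, star (w i k) * w j k = if i = j then (1 : ℂ) else 0) (j : ι) :
    (∑ i, (s i : ℂ) • outerP (u i) (w i)) *ᵥ w j = (s j : ℂ) • u j := by
  ext a
  rw [sum_smul_outerP_mulVec]
  simp only [hw]
  simp

theorem conjTranspose_sum_smul_outerP :
    (∑ i, (s i : ℂ) • outerP (u i) (w i))ᴴ = ∑ i, (s i : ℂ) • outerP (w i) (u i) := by
  ext b a
  simp [Matrix.sum_apply, outerP, mul_comm]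

end OuterProductExpansion

theorem isHermitian_tildeT_ρEx : (tildeT ρEx).IsHermitian := by
  ext a b
  rw [Matrix.conjTranspose_apply, tildeT_ρEx_apply, tildeT_ρEx_apply]
  by_cases ha : a = (0, 0) <;> by_cases hb : b = (0, 0) <;> simp [ha, hb]

theorem tildeT_ρEx_mulVec (v : Fin 2 × Fin 2 → ℂ) (a : Fin 2 × Fin 2) :
    (tildeT ρEx *ᵥ v) a = (v (0, 0) + v (0, 1) + v (1, 0) + v (1, 1)) / 8 +
      if a = (0, 0) then v (0, 0) / 2 else 0 := by
  simp only [Matrix.mulVec, dotProduct, tildeT_ρEx_apply, Fintype.sum_prod_type,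
    Fin.sum_univ_two]
  by_cases ha : a = (0, 0) <;> simp [ha] <;> ring

/-- A singular vector of `tildeT ρEx` with positive semidefinite matricization belongs to the
singular value `3 / 4`, so it is orthogonal to the eigenvector for the eigenvalue `1 / 4`. -/
theorem sub_eq_zero_of_tildeT_ρEx_mulVec {s : ℝ} {u w : Fin 2 × Fin 2 → ℂ} (hs : 0 < s)
    (hw : tildeT ρEx *ᵥ w = (s : ℂ) • u) (hu : tildeT ρEx *ᵥ u = (s : ℂ) • w)
    (hu0 : u ≠ 0) (hpos : (matM u).PosSemidef) :
    w (0, 0) - w (0, 1) - w (1, 0) - w (1, 1) = 0 := by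
  have hsc : (s : ℂ) ≠ 0 := by exact_mod_cast hs.ne'
  have hu' (a) := congrFun hu a
  have hw' (a) := congrFun hw a
  simp only [tildeT_ρEx_mulVec, Pi.smul_apply, smul_eq_mul] at hu' hw'
  have u00 := hw' (0, 0)
  have u01 := hw' (0, 1)
  have u10 := hw' (1, 0)
  have u11 := hw' (1, 1)
  have w00 := hu' (0, 0)
  have w01 := hu' (0, 1)
  have w10 := hu' (1, 0)
  have w11 := hu' (1, 1)
  simp at u00 u01 u10 u11 w00 w01 w10 w11
  have hu01 : u (0, 1) = u (1, 1) := mul_left_cancel₀ hsc (u01.symm.trans u11)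
  have hu10 : u (1, 0) = u (1, 1) := mul_left_cancel₀ hsc (u10.symm.trans u11)
  have hw01 : w (0, 1) = w (1, 1) := mul_left_cancel₀ hsc (w01.symm.trans w11)
  have hw10 : w (1, 0) = w (1, 1) := mul_left_cancel₀ hsc (w10.symm.trans w11)
  rw [hu01, hu10] at w00 w11
  rw [hw01, hw10] at u00 u11
  have h0 : 0 ≤ u (0, 0) := hpos.diag_nonneg
  have h1 : 0 ≤ u (1, 1) := hpos.diag_nonneg
  have hsum : u (0, 0) + u (1, 1) ≠ 0 := by
    intro h
    obtain ⟨h00, h11⟩ := (add_eq_zero_iff_of_nonneg h0 h1).1 h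
    apply hu0
    ext ⟨c, r⟩
    fin_cases c <;> fin_cases r <;> simp [hu01, hu10, h00, h11]
  have hs2 : (s : ℂ) ^ 2 = 9 / 16 := by
    apply mul_right_cancel₀ hsum
    linear_combination (-s : ℂ) * (u00 + u11) - 3 / 4 * (w00 + w11)
  have hg : (s : ℂ) ^ 2 * (w (0, 0) - 3 * w (1, 1)) = 1 / 16 * (w (0, 0) - 3 * w (1, 1)) := by
    linear_combination (-s : ℂ) * (w00 - 3 * w11) - 1 / 4 * (u00 - 3 * u11)
  rw [hw01, hw10]
  linear_combination 2 * hg - 2 * (w (0, 0) - 3 * w (1, 1)) * hs2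

/-- The state `ρ = (1/2)(P_{e₀} ⊗ P_{e₀} + P_x ⊗ P_x)` with `x = (e₀ + e₁)/√2`
is separable, yet `t(ρ)` admits no decomposition `∑ σᵢ |uᵢ⟩⟨wᵢ|` with `σᵢ > 0`,
orthonormal families `{uᵢ}`, `{wᵢ}`, and all matricizations `mat uᵢ`, `mat wᵢ`
positive semidefinite: the SVD criterion is sufficient but not necessary. -/
theorem separable_state_failing_svd_criterion :
    SeparableState ρEx ∧
      ¬ ∃ (q : ℕ) (σ : Fin q → ℝ) (u w : Fin q → (Fin 2 × Fin 2 → ℂ)),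
          (∀ i, 0 < σ i) ∧
          (∀ i j, ∑ k, star (u i k) * u j k = if i = j then (1 : ℂ) else 0) ∧
          (∀ i j, ∑ k, star (w i k) * w j k = if i = j then (1 : ℂ) else 0) ∧
          tildeT ρEx = ∑ i, (σ i : ℂ) • outerP (u i) (w i) ∧
          (∀ i, (matM (u i)).PosSemidef) ∧
          (∀ i, (matM (w i)).PosSemidef) := by
  refine ⟨separableState_ρEx, ?_⟩
  rintro ⟨q, s, u, w, hs, hu, hw, hT, hpu, -⟩
  have hT' : tildeT ρEx = ∑ i, (s i : ℂ) • outerP (w i) (u i) := by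
    rw [← conjTranspose_sum_smul_outerP, ← hT, isHermitian_tildeT_ρEx.eq]
  have horth (i : Fin q) : w i (0, 0) - w i (0, 1) - w i (1, 0) - w i (1, 1) = 0 := by
    refine sub_eq_zero_of_tildeT_ρEx_mulVec (hs i) ?_ ?_ ?_ (hpu i)
    · rw [hT, sum_smul_outerP_mulVec_right hw]
    · rw [hT', sum_smul_outerP_mulVec_right hu]
    · intro h0
      simpa [h0] using hu i i
  let v : Fin 2 × Fin 2 → ℂ := fun k => if k = (0, 0) then 1 else -1
  have hv (i : Fin q) : ∑ b, star (w i b) * v b = 0 := by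
    have h := congrArg star (horth i)
    simp only [star_sub, star_zero] at h
    simp only [v, Fintype.sum_prod_type, Fin.sum_univ_two]
    simp only [Prod.mk.injEq, and_true, and_false, one_ne_zero, if_true, if_false]
    linear_combination h
  have hzero : (tildeT ρEx *ᵥ v) (0, 0) = 0 := by
    rw [hT, sum_smul_outerP_mulVec]
    simp only [hv, mul_zero, Finset.sum_const_zero]
  rw [tildeT_ρEx_mulVec] at hzero
  norm_num [v] at hzero
end
end
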